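/- arXiv:1408.4389 — 15 statements merged into one kernel-verified Lean document; each statement's English description precedes it below -/
import Mathlib

section
/- Every quasi-submodular set function satisfies the single sub-crossing property: if F : Finset (Fin n) → ℝ is quasi-submodular, then for all A ⊆ B and every element i ∉ B: F(A) ≥ F(B) implies F(A ∪ {i}) ≥ F(B ∪ {i}), and F(A) > F(B) implies F(A ∪ {i}) > F(B ∪ {i}). -/
/-- Every quasi-submodular set function satisfies the single sub-crossing property. -/
theorem quasiSubmodular_ssbc {n : ℕ} (F : Finset (Fin n) → ℝ)
    (hqsb : ∀ X Y : Finset (Fin n),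
      (F (X ∩ Y) ≥ F X → F Y ≥ F (X ∪ Y)) ∧
      (F (X ∩ Y) > F X → F Y > F (X ∪ Y))) :
    ∀ A B : Finset (Fin n), A ⊆ B → ∀ i : Fin n, i ∉ B →
      (F A ≥ F B → F (A ∪ {i}) ≥ F (B ∪ {i})) ∧
      (F A > F B → F (A ∪ {i}) > F (B ∪ {i})) := by
  intro A B hAB i hi
  have hinter : B ∩ (A ∪ {i}) = A := by
    rw [Finset.inter_union_distrib_left, Finset.inter_eq_right.mpr hAB,
      Finset.inter_singleton_of_notMem hi, Finset.union_empty]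
  have hunion : B ∪ (A ∪ {i}) = B ∪ {i} := by
    rw [← Finset.union_assoc, Finset.union_eq_left.mpr hAB]
  simpa only [hinter, hunion] using hqsb B (A ∪ {i})
end

section
/- Every set function satisfying the single sub-crossing property is quasi-submodular: if F : Finset (Fin n) → ℝ satisfies the SSBC property, then for all X, Y: F(X ∩ Y) ≥ F(X) implies F(Y) ≥ F(X ∪ Y), and F(X ∩ Y) > F(X) implies F(Y) > F(X ∪ Y). -/
/-- The single sub-crossing property extends from single elements to sets disjoint from `B`. -/
theorem ssbc_union_of_disjoint {α β : Type*} [DecidableEq α] [Preorder β] {F : Finset α → β}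
    (hssbc : ∀ A B : Finset α, A ⊆ B → ∀ i : α, i ∉ B →
      (F A ≥ F B → F (A ∪ {i}) ≥ F (B ∪ {i})) ∧
      (F A > F B → F (A ∪ {i}) > F (B ∪ {i})))
    {A B : Finset α} (hAB : A ⊆ B) (S : Finset α) (hS : Disjoint B S) :
    (F A ≥ F B → F (A ∪ S) ≥ F (B ∪ S)) ∧ (F A > F B → F (A ∪ S) > F (B ∪ S)) := by
  induction S using Finset.induction_on with
  | empty => simp
  | insert i S hi ih =>
    rw [Finset.disjoint_insert_right] at hS
    have key := hssbc (A ∪ S) (B ∪ S) (Finset.union_subset_union_left hAB) i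
      (by simp [hS.1, hi])
    have h_insert (C : Finset α) : C ∪ insert i S = C ∪ S ∪ {i} := by grind
    rw [h_insert, h_insert]
    exact ⟨fun h => key.1 ((ih hS.2).1 h), fun h => key.2 ((ih hS.2).2 h)⟩

/-- Every set function satisfying the single sub-crossing property is quasi-submodular. -/
theorem ssbc_is_quasiSubmodular {n : ℕ} (F : Finset (Fin n) → ℝ)
    (hssbc : ∀ A B : Finset (Fin n), A ⊆ B → ∀ i : Fin n, i ∉ B →
      (F A ≥ F B → F (A ∪ {i}) ≥ F (B ∪ {i})) ∧
      (F A > F B → F (A ∪ {i}) > F (B ∪ {i}))) :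
    ∀ X Y : Finset (Fin n),
      (F (X ∩ Y) ≥ F X → F Y ≥ F (X ∪ Y)) ∧
      (F (X ∩ Y) > F X → F Y > F (X ∪ Y)) := by
  intro X Y
  have h := ssbc_union_of_disjoint hssbc (Finset.inter_subset_left (s₁ := X) (s₂ := Y)) (Y \ X)
    Finset.disjoint_sdiff
  have hY : X ∩ Y ∪ Y \ X = Y := by grind
  rwa [hY, Finset.union_sdiff_self_eq_union] at h
end

section
/- If F : Finset (Fin n) → ℝ is quasi-submodular, then for all A ⊆ B and every element i ∉ B: if F(A ∪ {i}) ≤ F(A) then F(B ∪ {i}) ≤ F(B), and if F(A ∪ {i}) < F(A) then F(B ∪ {i}) < F(B) (the marginal gain of i, F(i|A) := F(A ∪ {i}) − F(A), being nonpositive/negative at A implies it is nonpositive/negative at B). -/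
/-- For a quasi-submodular function, a nonpositive (negative) marginal gain of `i` at `A`
implies a nonpositive (negative) marginal gain of `i` at any superset `B` with `i ∉ B`. -/
theorem quasiSubmodular_marginal_gain {n : ℕ} (F : Finset (Fin n) → ℝ)
    (hqsb : ∀ X Y : Finset (Fin n),
      (F (X ∩ Y) ≥ F X → F Y ≥ F (X ∪ Y)) ∧
      (F (X ∩ Y) > F X → F Y > F (X ∪ Y))) :
    ∀ A B : Finset (Fin n), A ⊆ B → ∀ i : Fin n, i ∉ B →
      (F (A ∪ {i}) ≤ F A → F (B ∪ {i}) ≤ F B) ∧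
      (F (A ∪ {i}) < F A → F (B ∪ {i}) < F B) := by
  intro A B hAB i hi
  have h_inter : (A ∪ {i}) ∩ B = A := by
    rw [Finset.union_inter_distrib_right, Finset.inter_eq_left.mpr hAB,
      Finset.singleton_inter_of_notMem hi, Finset.union_empty]
  have h_union : A ∪ {i} ∪ B = B ∪ {i} := by
    rw [Finset.union_right_comm, Finset.union_eq_right.mpr hAB]
  simpa only [h_inter, h_union] using hqsb (A ∪ {i}) B
end

section
/- Upward step of the quasi-submodular minimization algorithm strictly decreases the objective: let F : Finset (Fin n) → ℝ be quasi-submodular, let X be any subset of Fin n, and let U = {u ∉ X : F(X ∪ {u}) < F(X)}. If U is nonempty, then F(X ∪ U) < F(X). -/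
open scoped Classical

/-- Upward step of the quasi-submodular minimization algorithm strictly decreases
the objective. -/
theorem uqsfmin_up_step {n : ℕ} (F : Finset (Fin n) → ℝ)
    (hqsb : ∀ X Y : Finset (Fin n),
      (F (X ∩ Y) ≥ F X → F Y ≥ F (X ∪ Y)) ∧
      (F (X ∩ Y) > F X → F Y > F (X ∪ Y)))
    (X : Finset (Fin n))
    (U : Finset (Fin n)) (hU : U = Finset.univ.filter (fun u => u ∉ X ∧ F (X ∪ {u}) < F X))
    (hne : U.Nonempty) :
    F (X ∪ U) < F X := by
  have key : ∀ S : Finset (Fin n), S ⊆ U → S.Nonempty → F (X ∪ S) < F X := by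
    intro S
    induction S using Finset.induction_on with
    | empty => intro _ h; simp at h
    | insert u S hu ih =>
      intro hS _
      obtain ⟨huU, hSU⟩ := Finset.insert_subset_iff.mp hS
      have hlt : F (X ∪ {u}) < F X := by
        rw [hU] at huU
        exact (Finset.mem_filter.mp huU).2.2
      have hinter : (X ∪ {u}) ∩ (X ∪ S) = X := by
        rw [← Finset.union_inter_distrib_left, Finset.singleton_inter_of_notMem hu,
          Finset.union_empty]
      have hunion : (X ∪ {u}) ∪ (X ∪ S) = X ∪ insert u S := by
        ext a; simp only [Finset.mem_union, Finset.mem_singleton, Finset.mem_insert]; tauto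
      have hstep := (hqsb (X ∪ {u}) (X ∪ S)).2 (by rwa [hinter])
      rw [hunion] at hstep
      rcases S.eq_empty_or_nonempty with rfl | hSne
      · simpa using hlt
      · exact lt_trans hstep (ih hSU hSne)
  exact key U subset_rfl hne
end

section
/- Downward step of the quasi-submodular minimization algorithm strictly decreases the objective: let F : Finset (Fin n) → ℝ be quasi-submodular, let Y be any subset of Fin n, and let D = {d ∈ Y : F(Y \ {d}) < F(Y)}. If D is nonempty, then F(Y \ D) < F(Y). -/
open scoped Classical

/-- If removing each single element of a nonempty `S ⊆ Y` strictly decreases a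
quasi-submodular function, then so does removing all of `S`. -/
theorem quasiSubmodular_sdiff_lt {α : Type*} [DecidableEq α] (F : Finset α → ℝ)
    (hF : ∀ X Y : Finset α, F (X ∩ Y) ≥ F X → F Y ≥ F (X ∪ Y))
    (Y S : Finset α) (hS : S.Nonempty) (h : ∀ d ∈ S, F (Y \ {d}) < F Y) :
    F (Y \ S) < F Y := by
  induction hS using Finset.Nonempty.cons_induction with
  | singleton a => exact h a (Finset.mem_singleton_self a)
  | cons a s ha hs ih =>
    have hs_lt : F (Y \ s) < F Y := ih fun d hd => h d (Finset.mem_cons_of_mem hd)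
    have ha_lt : F (Y \ {a}) < F Y := h a (Finset.mem_cons_self a s)
    have h_inter : Y \ s ∩ (Y \ {a}) = Y \ Finset.cons a s ha := by
      ext x
      simp only [Finset.mem_inter, Finset.mem_sdiff, Finset.mem_singleton, Finset.mem_cons]
      tauto
    have h_union : Y \ s ∪ Y \ {a} = Y := by
      ext x
      simp only [Finset.mem_union, Finset.mem_sdiff, Finset.mem_singleton]
      grind
    have key := hF (Y \ s) (Y \ {a})
    rw [h_inter, h_union] at key
    by_contra! h_le
    exact absurd (key (hs_lt.le.trans h_le)) (not_le.mpr ha_lt)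

/-- Downward step of the quasi-submodular minimization algorithm strictly decreases
the objective. -/
theorem uqsfmin_down_step {n : ℕ} (F : Finset (Fin n) → ℝ)
    (hqsb : ∀ X Y : Finset (Fin n),
      (F (X ∩ Y) ≥ F X → F Y ≥ F (X ∪ Y)) ∧
      (F (X ∩ Y) > F X → F Y > F (X ∪ Y)))
    (Y : Finset (Fin n))
    (D : Finset (Fin n)) (hD : D = Y.filter (fun d => F (Y \ {d}) < F Y))
    (hne : D.Nonempty) :
    F (Y \ D) < F Y := by
  refine quasiSubmodular_sdiff_lt F (fun X Z => (hqsb X Z).1) Y D hne fun d hd => ?_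
  rw [hD] at hd
  exact (Finset.mem_filter.mp hd).2
end

section
/- Any global minimum of a quasi-submodular function lies in the lattice [Q₁, S₁]: let F : Finset (Fin n) → ℝ be quasi-submodular with ground set N = Finset.univ, let Q₁ = {i : F({i}) < F(∅)} and S₁ = {i : F(N) ≤ F(N \ {i})}. Then for every X* minimizing F over all subsets of N, Q₁ ⊆ X* ⊆ S₁. -/
open scoped Classical

/-- Any global minimum of a quasi-submodular function lies in the lattice `[Q₁, S₁]`. -/
theorem uqsfmin_global_min_in_lattice {n : ℕ} (F : Finset (Fin n) → ℝ)
    (hqsb : ∀ X Y : Finset (Fin n),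
      (F (X ∩ Y) ≥ F X → F Y ≥ F (X ∪ Y)) ∧
      (F (X ∩ Y) > F X → F Y > F (X ∪ Y)))
    (Q₁ S₁ : Finset (Fin n))
    (hQ : Q₁ = Finset.univ.filter (fun i => F {i} < F ∅))
    (hS : S₁ = Finset.univ.filter (fun i => F Finset.univ ≤ F (Finset.univ \ {i})))
    (Xstar : Finset (Fin n)) (hmin : ∀ X : Finset (Fin n), F Xstar ≤ F X) :
    Q₁ ⊆ Xstar ∧ Xstar ⊆ S₁ := by
  subst hQ hS
  constructor
  · intro i hi
    have hlt : F {i} < F ∅ := (Finset.mem_filter.mp hi).2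
    by_contra hiX
    have hinter : {i} ∩ Xstar = ∅ := Finset.singleton_inter_of_notMem hiX
    refine ((hqsb {i} Xstar).2 ?_).not_ge (hmin _)
    rwa [hinter]
  · intro i hi
    have hunion : Xstar ∪ (Finset.univ \ {i}) = Finset.univ := by
      ext j
      by_cases hj : j = i <;> simp [hj, hi]
    have hle := (hqsb Xstar (Finset.univ \ {i})).1 (hmin _)
    rw [hunion] at hle
    exact Finset.mem_filter.mpr ⟨Finset.mem_univ i, hle⟩
end

section
/- For a quasi-submodular function F : Finset (Fin n) → ℝ with ground set N = Finset.univ, the lattice [Q₁, S₁] is nonempty: {i : F({i}) < F(∅)} ⊆ {i : F(N) ≤ F(N \ {i})}. -/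
open scoped Classical

/-- For a quasi-submodular function, the lattice `[Q₁, S₁]` is nonempty: `Q₁ ⊆ S₁`. -/
theorem uqsfmin_lattice_nonempty {n : ℕ} (F : Finset (Fin n) → ℝ)
    (hqsb : ∀ X Y : Finset (Fin n),
      (F (X ∩ Y) ≥ F X → F Y ≥ F (X ∪ Y)) ∧
      (F (X ∩ Y) > F X → F Y > F (X ∪ Y))) :
    Finset.univ.filter (fun i : Fin n => F {i} < F ∅) ⊆
      Finset.univ.filter (fun i : Fin n => F Finset.univ ≤ F (Finset.univ \ {i})) := by
  intro i hi
  rw [Finset.mem_filter] at hi ⊢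
  refine ⟨hi.1, ?_⟩
  have h := (hqsb {i} (Finset.univ \ {i})).2
  rw [Finset.inter_sdiff_self, Finset.union_sdiff_of_subset (Finset.subset_univ _)] at h
  exact (h hi.2).le
end

section
/- Inductive step showing every local minimum stays inside the working lattice of the minimization algorithm: let F : Finset (Fin n) → ℝ be quasi-submodular, let P be a local minimum of F, and let Q ⊆ P ⊆ S be subsets of Fin n. Let U = {u ∉ Q : F(Q ∪ {u}) < F(Q)} and D = {d ∈ S : F(S \ {d}) < F(S)}. Then Q ∪ U ⊆ P ⊆ S \ D. -/
open scoped Classical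

/-- Inductive step: every local minimum stays inside the working lattice of the
quasi-submodular minimization algorithm. -/
theorem uqsfmin_local_min_step {n : ℕ} (F : Finset (Fin n) → ℝ)
    (hqsb : ∀ X Y : Finset (Fin n),
      (F (X ∩ Y) ≥ F X → F Y ≥ F (X ∪ Y)) ∧
      (F (X ∩ Y) > F X → F Y > F (X ∪ Y)))
    (P : Finset (Fin n))
    (hlocmin : (∀ i ∈ P, F (P \ {i}) ≥ F P) ∧ (∀ j ∉ P, F (P ∪ {j}) ≥ F P))
    (Q S : Finset (Fin n)) (hQP : Q ⊆ P) (hPS : P ⊆ S)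
    (U D : Finset (Fin n))
    (hU : U = Finset.univ.filter (fun u => u ∉ Q ∧ F (Q ∪ {u}) < F Q))
    (hD : D = S.filter (fun d => F (S \ {d}) < F S)) :
    Q ∪ U ⊆ P ∧ P ⊆ S \ D := by
  subst hU hD
  refine ⟨Finset.union_subset hQP fun u hu => ?_, fun d hd => ?_⟩
  · obtain ⟨huQ, hlt⟩ := (Finset.mem_filter.mp hu).2
    by_contra huP
    have hinter : (Q ∪ {u}) ∩ P = Q := by grind
    have hunion : (Q ∪ {u}) ∪ P = P ∪ {u} := by grind
    have h := (hqsb (Q ∪ {u}) P).2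
    rw [hinter, hunion] at h
    exact (h hlt).not_ge (hlocmin.2 u huP)
  · refine Finset.mem_sdiff.mpr ⟨hPS hd, fun hdD => ?_⟩
    have hinter : P ∩ (S \ {d}) = P \ {d} := by grind
    have hunion : P ∪ (S \ {d}) = S := by grind
    have h := (hqsb P (S \ {d})).1
    rw [hinter, hunion] at h
    exact (Finset.mem_filter.mp hdD).2.not_ge (h (hlocmin.1 d hd))
end

section
/- The working lattice of the quasi-submodular maximization algorithm stays nonempty: let F : Finset (Fin n) → ℝ be quasi-submodular and X ⊆ Y ⊆ Fin n. Let U = {u ∈ Y \ X : F(Y) > F(Y \ {u})} and D = {d ∈ Y \ X : F(X ∪ {d}) < F(X)}. Then U and D are disjoint, and consequently X ∪ U ⊆ Y \ D. -/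
open scoped Classical

/-- The working lattice of the quasi-submodular maximization algorithm stays nonempty:
the added set `U` and removed set `D` are disjoint, hence `X ∪ U ⊆ Y \ D`. -/
theorem uqsfmax_lattice_nonempty_step {n : ℕ} (F : Finset (Fin n) → ℝ)
    (hqsb : ∀ X Y : Finset (Fin n),
      (F (X ∩ Y) ≥ F X → F Y ≥ F (X ∪ Y)) ∧
      (F (X ∩ Y) > F X → F Y > F (X ∪ Y)))
    (X Y : Finset (Fin n)) (hXY : X ⊆ Y)
    (U D : Finset (Fin n))
    (hU : U = (Y \ X).filter (fun u => F Y > F (Y \ {u})))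
    (hD : D = (Y \ X).filter (fun d => F (X ∪ {d}) < F X)) :
    Disjoint U D ∧ X ∪ U ⊆ Y \ D := by
  have hdisj : Disjoint U D := by
    subst hU hD
    rw [Finset.disjoint_left]
    intro e heU heD
    simp only [Finset.mem_filter, Finset.mem_sdiff] at heU heD
    obtain ⟨⟨heY, heX⟩, hFY⟩ := heU
    have hinter : (X ∪ {e}) ∩ (Y \ {e}) = X := by
      ext a
      have := @hXY a
      simp only [Finset.mem_inter, Finset.mem_union, Finset.mem_sdiff, Finset.mem_singleton]
      grind
    have hunion : (X ∪ {e}) ∪ (Y \ {e}) = Y := by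
      ext a
      have := @hXY a
      simp only [Finset.mem_union, Finset.mem_sdiff, Finset.mem_singleton]
      grind
    have h := (hqsb (X ∪ {e}) (Y \ {e})).2
    rw [hinter, hunion] at h
    exact lt_asymm hFY (h heD.2)
  refine ⟨hdisj, Finset.union_subset ?_ ?_⟩
  · intro a ha
    simp [hD, hXY ha, ha]
  · refine Finset.subset_sdiff.2 ⟨?_, hdisj⟩
    rw [hU]
    exact (Finset.filter_subset _ _).trans Finset.sdiff_subset
end

section
/- Lower-endpoint step of the quasi-submodular maximization algorithm strictly increases the objective: let F : Finset (Fin n) → ℝ be quasi-submodular, let X ⊆ Y ⊆ Fin n, and let U = {u ∈ Y \ X : F(Y) > F(Y \ {u})}. If U is nonempty, then F(X ∪ U) > F(X). -/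
open scoped Classical

/-- If removing `u` from `Y` strictly decreases a quasi-submodular function, then so does removing
`u` from any subset of `Y` containing it. -/
theorem lt_of_sdiff_singleton_lt {n : ℕ} {F : Finset (Fin n) → ℝ}
    (hF : ∀ X Y : Finset (Fin n), F X ≤ F (X ∩ Y) → F (X ∪ Y) ≤ F Y)
    {A Y : Finset (Fin n)} (hAY : A ⊆ Y) {u : Fin n} (hu : u ∈ A)
    (h : F (Y \ {u}) < F Y) : F (A \ {u}) < F A := by
  by_contra! hle
  have hinter : A ∩ (Y \ {u}) = A \ {u} := by grind
  have hunion : A ∪ (Y \ {u}) = Y := by grind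
  have := hF A (Y \ {u})
  rw [hinter, hunion] at this
  exact (this hle).not_gt h

/-- Lower-endpoint step of the quasi-submodular maximization algorithm strictly
increases the objective. -/
theorem uqsfmax_lower_step {n : ℕ} (F : Finset (Fin n) → ℝ)
    (hqsb : ∀ X Y : Finset (Fin n),
      (F (X ∩ Y) ≥ F X → F Y ≥ F (X ∪ Y)) ∧
      (F (X ∩ Y) > F X → F Y > F (X ∪ Y)))
    (X Y : Finset (Fin n)) (hXY : X ⊆ Y)
    (U : Finset (Fin n)) (hU : U = (Y \ X).filter (fun u => F Y > F (Y \ {u})))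
    (hne : U.Nonempty) :
    F (X ∪ U) > F X := by
  have hmem : ∀ u ∈ U, u ∈ Y ∧ u ∉ X ∧ F (Y \ {u}) < F Y := by
    intro u hu
    simpa [hU, and_assoc] using hu
  have hstep : ∀ S ⊆ U, S.Nonempty → F X < F (X ∪ S) := by
    intro S
    induction S using Finset.induction_on with
    | empty => simp
    | insert a S ha ih =>
      intro hS _
      obtain ⟨-, haX, haF⟩ := hmem a (hS (Finset.mem_insert_self a S))
      have hsub : X ∪ insert a S ⊆ Y :=
        Finset.union_subset hXY fun u hu => (hmem u (hS hu)).1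
      have hlt := lt_of_sdiff_singleton_lt (fun A B => (hqsb A B).1) hsub
        (Finset.mem_union_right X (Finset.mem_insert_self a S)) haF
      have hdiff : (X ∪ insert a S) \ {a} = X ∪ S := by grind
      rw [hdiff] at hlt
      rcases S.eq_empty_or_nonempty with rfl | hne'
      · simpa using hlt
      · exact (ih ((Finset.subset_insert a S).trans hS) hne').trans hlt
  exact hstep U subset_rfl hne
end

section
/- Upper-endpoint step of the quasi-submodular maximization algorithm strictly increases the objective: let F : Finset (Fin n) → ℝ be quasi-submodular, let X ⊆ Y ⊆ Fin n, and let D = {d ∈ Y \ X : F(X ∪ {d}) < F(X)}. If D is nonempty, then F(Y \ D) > F(Y). -/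
open scoped Classical

/-- If adding any single element of a nonempty set `S` to `X` strictly decreases a
quasi-submodular `F`, then so does adding all of `S` to a superset of `X` disjoint from `S`. -/
theorem union_lt_of_forall_union_singleton_lt {α β : Type*} [DecidableEq α] [Preorder β]
    {F : Finset α → β}
    (hF : ∀ X Y : Finset α, F (X ∩ Y) > F X → F Y > F (X ∪ Y))
    {X B S : Finset α} (hXB : X ⊆ B) (hS : S.Nonempty) (hBS : Disjoint B S)
    (hlt : ∀ d ∈ S, F (X ∪ {d}) < F X) :
    F (B ∪ S) < F B := by
  have step : ∀ (C : Finset α) (d : α), X ⊆ C → d ∉ C → F (X ∪ {d}) < F X →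
      F (C ∪ {d}) < F C := by
    intro C d hXC hdC hd
    have hinter : (X ∪ {d}) ∩ C = X := by grind
    have hunion : (X ∪ {d}) ∪ C = C ∪ {d} := by grind
    have h := hF (X ∪ {d}) C
    rw [hinter, hunion] at h
    exact h hd
  induction hS using Finset.Nonempty.cons_induction with
  | singleton a =>
    exact step B a hXB (by simpa using hBS) (hlt a (by simp))
  | cons a s ha hs ih =>
    rw [Finset.cons_eq_insert] at hBS hlt ⊢
    rw [Finset.disjoint_insert_right] at hBS
    have hunion : B ∪ insert a s = (B ∪ s) ∪ {a} := by grind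
    rw [hunion]
    exact (step (B ∪ s) a (hXB.trans Finset.subset_union_left) (by simp [hBS.1, ha])
      (hlt a (by simp))).trans
      (ih hBS.2 fun d hd => hlt d (Finset.mem_insert_of_mem hd))

/-- Upper-endpoint step of the quasi-submodular maximization algorithm strictly
increases the objective. -/
theorem uqsfmax_upper_step {n : ℕ} (F : Finset (Fin n) → ℝ)
    (hqsb : ∀ X Y : Finset (Fin n),
      (F (X ∩ Y) ≥ F X → F Y ≥ F (X ∪ Y)) ∧
      (F (X ∩ Y) > F X → F Y > F (X ∪ Y)))
    (X Y : Finset (Fin n)) (hXY : X ⊆ Y)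
    (D : Finset (Fin n)) (hD : D = (Y \ X).filter (fun d => F (X ∪ {d}) < F X))
    (hne : D.Nonempty) :
    F (Y \ D) > F Y := by
  have hmem : ∀ d, d ∈ D ↔ (d ∈ Y ∧ d ∉ X) ∧ F (X ∪ {d}) < F X := by
    simp [hD]
  have hDY : D ⊆ Y := fun d hd => ((hmem d).1 hd).1.1
  have hXB : X ⊆ Y \ D := fun x hx =>
    Finset.mem_sdiff.2 ⟨hXY hx, fun h => ((hmem x).1 h).1.2 hx⟩
  have h := union_lt_of_forall_union_singleton_lt (fun A B => (hqsb A B).2) hXB hne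
    Finset.sdiff_disjoint fun d hd => ((hmem d).1 hd).2
  rwa [Finset.sdiff_union_of_subset hDY] at h
end

section
/- Any global maximum of a quasi-submodular function lies in the lattice [X₁, Y₁]: let F : Finset (Fin n) → ℝ be quasi-submodular with ground set N = Finset.univ, let X₁ = {i : F(N) > F(N \ {i})} and Y₁ = {i : F({i}) ≥ F(∅)}. Then for every X* maximizing F over all subsets of N, X₁ ⊆ X* ⊆ Y₁. -/
open scoped Classical

/-- Any global maximum of a quasi-submodular function lies in the lattice `[X₁, Y₁]`. -/
theorem uqsfmax_global_max_in_lattice {n : ℕ} (F : Finset (Fin n) → ℝ)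
    (hqsb : ∀ X Y : Finset (Fin n),
      (F (X ∩ Y) ≥ F X → F Y ≥ F (X ∪ Y)) ∧
      (F (X ∩ Y) > F X → F Y > F (X ∪ Y)))
    (X₁ Y₁ : Finset (Fin n))
    (hX : X₁ = Finset.univ.filter (fun i => F Finset.univ > F (Finset.univ \ {i})))
    (hY : Y₁ = Finset.univ.filter (fun i => F {i} ≥ F ∅))
    (Xstar : Finset (Fin n)) (hmax : ∀ X : Finset (Fin n), F Xstar ≥ F X) :
    X₁ ⊆ Xstar ∧ Xstar ⊆ Y₁ := by
  subst hX hY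
  constructor
  · intro i hi
    have h_lt : F Finset.univ > F (Finset.univ \ {i}) := (Finset.mem_filter.mp hi).2
    by_contra h_notMem
    have h_inter : insert i Xstar ∩ (Finset.univ \ {i}) = Xstar := by
      ext j
      by_cases hj : j = i <;> simp [hj, h_notMem]
    have h_union : insert i Xstar ∪ (Finset.univ \ {i}) = Finset.univ := by
      ext j
      by_cases hj : j = i <;> simp [hj]
    have h_le := (hqsb (insert i Xstar) (Finset.univ \ {i})).1
    rw [h_inter, h_union] at h_le
    exact absurd h_lt (h_le (hmax _)).not_gt
  · intro i hi
    refine Finset.mem_filter.mpr ⟨Finset.mem_univ i, ?_⟩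
    by_contra! h_lt
    have h_inter : {i} ∩ (Xstar \ {i}) = ∅ := Finset.inter_sdiff_self {i} Xstar
    have h_union : {i} ∪ (Xstar \ {i}) = Xstar :=
      Finset.union_sdiff_of_subset (Finset.singleton_subset_iff.mpr hi)
    have h_gt := (hqsb {i} (Xstar \ {i})).2
    rw [h_inter, h_union] at h_gt
    exact absurd (h_gt h_lt) (hmax _).not_gt
end

section
/- Inductive step showing every global maximum stays inside the working lattice of the maximization algorithm: let F : Finset (Fin n) → ℝ be quasi-submodular, let X* be a global maximum of F over all subsets of Fin n, and let X ⊆ X* ⊆ Y. Let U = {u ∈ Y \ X : F(Y) > F(Y \ {u})} and D = {d ∈ Y \ X : F(X ∪ {d}) < F(X)}. Then X ∪ U ⊆ X* ⊆ Y \ D. -/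
open scoped Classical

/-- Inductive step: every global maximum stays inside the working lattice of the
quasi-submodular maximization algorithm. -/
theorem uqsfmax_global_max_step {n : ℕ} (F : Finset (Fin n) → ℝ)
    (hqsb : ∀ X Y : Finset (Fin n),
      (F (X ∩ Y) ≥ F X → F Y ≥ F (X ∪ Y)) ∧
      (F (X ∩ Y) > F X → F Y > F (X ∪ Y)))
    (Xstar : Finset (Fin n)) (hmax : ∀ X : Finset (Fin n), F Xstar ≥ F X)
    (X Y : Finset (Fin n)) (hXstar : X ⊆ Xstar) (hstarY : Xstar ⊆ Y)
    (U D : Finset (Fin n))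
    (hU : U = (Y \ X).filter (fun u => F Y > F (Y \ {u})))
    (hD : D = (Y \ X).filter (fun d => F (X ∪ {d}) < F X)) :
    X ∪ U ⊆ Xstar ∧ Xstar ⊆ Y \ D := by
  subst hU hD
  constructor
  · refine Finset.union_subset hXstar fun u hu => ?_
    obtain ⟨huYX, hlt⟩ := Finset.mem_filter.mp hu
    have huY : u ∈ Y := (Finset.mem_sdiff.mp huYX).1
    by_contra hus
    have hinter : (Xstar ∪ {u}) ∩ (Y \ {u}) = Xstar := by grind
    have hunion : (Xstar ∪ {u}) ∪ (Y \ {u}) = Y := by grind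
    have h := (hqsb (Xstar ∪ {u}) (Y \ {u})).1
    rw [hinter, hunion] at h
    exact (h (hmax _)).not_gt hlt
  · intro d hd
    refine Finset.mem_sdiff.mpr ⟨hstarY hd, fun hdD => ?_⟩
    obtain ⟨hdYX, hlt⟩ := Finset.mem_filter.mp hdD
    have hdX : d ∉ X := (Finset.mem_sdiff.mp hdYX).2
    have hinter : (X ∪ {d}) ∩ (Xstar \ {d}) = X := by grind
    have hunion : (X ∪ {d}) ∪ (Xstar \ {d}) = Xstar := by grind
    have h := (hqsb (X ∪ {d}) (Xstar \ {d})).2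
    rw [hinter, hunion] at h
    exact (h hlt).not_ge (hmax _)
end

section
/- Inductive step showing every local maximum stays inside the working lattice of the maximization algorithm: let F : Finset (Fin n) → ℝ be quasi-submodular, let P be a local maximum of F, and let X ⊆ P ⊆ Y. Let U = {u ∈ Y \ X : F(Y) > F(Y \ {u})} and D = {d ∈ Y \ X : F(X ∪ {d}) < F(X)}. Then X ∪ U ⊆ P ⊆ Y \ D. -/
open scoped Classical

theorem union_singleton_inter_sdiff {α : Type*} [DecidableEq α] {A B : Finset α} {a : α}
    (hAB : A ⊆ B) (ha : a ∉ A) : (A ∪ {a}) ∩ (B \ {a}) = A := by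
  grind

theorem union_singleton_union_sdiff {α : Type*} [DecidableEq α] {A B : Finset α} {a : α}
    (hAB : A ⊆ B) (ha : a ∈ B) : (A ∪ {a}) ∪ (B \ {a}) = B := by
  grind

/-- Inductive step: every local maximum stays inside the working lattice of the
quasi-submodular maximization algorithm. -/
theorem uqsfmax_local_max_step {n : ℕ} (F : Finset (Fin n) → ℝ)
    (hqsb : ∀ X Y : Finset (Fin n),
      (F (X ∩ Y) ≥ F X → F Y ≥ F (X ∪ Y)) ∧
      (F (X ∩ Y) > F X → F Y > F (X ∪ Y)))
    (P : Finset (Fin n))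
    (hlocmax : (∀ i ∈ P, F (P \ {i}) ≤ F P) ∧ (∀ j ∉ P, F (P ∪ {j}) ≤ F P))
    (X Y : Finset (Fin n)) (hXP : X ⊆ P) (hPY : P ⊆ Y)
    (U D : Finset (Fin n))
    (hU : U = (Y \ X).filter (fun u => F Y > F (Y \ {u})))
    (hD : D = (Y \ X).filter (fun d => F (X ∪ {d}) < F X)) :
    X ∪ U ⊆ P ∧ P ⊆ Y \ D := by
  subst hU hD
  constructor
  · refine Finset.union_subset hXP fun u hu => ?_
    obtain ⟨huYX, hlt⟩ := Finset.mem_filter.mp hu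
    have huY := (Finset.mem_sdiff.mp huYX).1
    by_contra huP
    have hle := (hqsb (P ∪ {u}) (Y \ {u})).1
    rw [union_singleton_inter_sdiff hPY huP, union_singleton_union_sdiff hPY huY] at hle
    exact (hle (hlocmax.2 u huP)).not_gt hlt
  · intro d hdP
    refine Finset.mem_sdiff.mpr ⟨hPY hdP, fun hd => ?_⟩
    obtain ⟨hdYX, hlt⟩ := Finset.mem_filter.mp hd
    have hdX := (Finset.mem_sdiff.mp hdYX).2
    have hgt := (hqsb (X ∪ {d}) (P \ {d})).2
    rw [union_singleton_inter_sdiff hXP hdX, union_singleton_union_sdiff hXP hdP] at hgt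
    exact (hlocmax.1 d hdP).not_gt (hgt hlt)
end

section
/- Nested structure of minimizers of a quasi-submodular function (Milgrom–Shannon, reformulated): let F : Finset (Fin n) → ℝ be quasi-submodular and A ⊆ B ⊆ Fin n. If S_A minimizes F over all subsets of A and S'_B minimizes F over all subsets of B, then S_A ∪ S'_B also minimizes F over all subsets of B; in particular there exist minimizers S_A over subsets of A and S_B over subsets of B with S_A ⊆ S_B. -/
/-- Nested structure of minimizers of a quasi-submodular function (Milgrom–Shannon,
reformulated): if `S_A` minimizes `F` over subsets of `A` and `S'_B` minimizes `F` over
subsets of `B ⊇ A`, then `S_A ∪ S'_B` minimizes `F` over subsets of `B`; in particular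
there are nested minimizers. -/
theorem quasiSubmodular_nested_minimizers {n : ℕ} (F : Finset (Fin n) → ℝ)
    (hqsb : ∀ X Y : Finset (Fin n),
      (F (X ∩ Y) ≥ F X → F Y ≥ F (X ∪ Y)) ∧
      (F (X ∩ Y) > F X → F Y > F (X ∪ Y)))
    (A B : Finset (Fin n)) (hAB : A ⊆ B)
    (SA SB' : Finset (Fin n))
    (hSA : SA ⊆ A ∧ ∀ T : Finset (Fin n), T ⊆ A → F SA ≤ F T)
    (hSB' : SB' ⊆ B ∧ ∀ T : Finset (Fin n), T ⊆ B → F SB' ≤ F T) :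
    ((SA ∪ SB' ⊆ B ∧ ∀ T : Finset (Fin n), T ⊆ B → F (SA ∪ SB') ≤ F T) ∧
      ∃ SA' SB : Finset (Fin n),
        (SA' ⊆ A ∧ ∀ T : Finset (Fin n), T ⊆ A → F SA' ≤ F T) ∧
        (SB ⊆ B ∧ ∀ T : Finset (Fin n), T ⊆ B → F SB ≤ F T) ∧
        SA' ⊆ SB) := by
  have hunion : SA ∪ SB' ⊆ B ∧ ∀ T : Finset (Fin n), T ⊆ B → F (SA ∪ SB') ≤ F T :=
    ⟨Finset.union_subset (hSA.1.trans hAB) hSB'.1, fun T hT =>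
      ((hqsb SA SB').1 (hSA.2 _ (Finset.inter_subset_left.trans hSA.1))).trans (hSB'.2 T hT)⟩
  exact ⟨hunion, SA, SA ∪ SB', hSA, hunion, Finset.subset_union_left⟩
end
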